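/- (Dispersive estimate) Let −1 ≤ α ≤ 1 and α/2 − 1 < Re β < α/2. Then for all ψ ∈ L¹(ℝ²) and t ≠ 0, ‖D_x^β W_α(t) ψ‖_{L^∞(ℝ²)} ≲ |t|^{−(5+2β−α)/6} ‖ψ‖_{L¹(ℝ²)}. -/

import Mathlib

open MeasureTheory Filter
open scoped ENNReal

noncomputable section

/-- Fourier transform on ℝ². -/
def FT2 (f : ℝ × ℝ → ℂ) : ℝ × ℝ → ℂ := fun p =>
  ∫ q : ℝ × ℝ, Complex.exp (-((2 * Real.pi * (p.1 * q.1 + p.2 * q.2) : ℝ) : ℂ) * Complex.I) * f q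

/-- Inverse Fourier transform on ℝ². -/
def IFT2 (f : ℝ × ℝ → ℂ) : ℝ × ℝ → ℂ := fun x =>
  ∫ p : ℝ × ℝ, Complex.exp (((2 * Real.pi * (x.1 * p.1 + x.2 * p.2) : ℝ) : ℂ) * Complex.I) * f p

/-- Homogeneous fractional derivative in `x`, symbol `|ξ|^s`. -/
def Dx (s : ℝ) (f : ℝ × ℝ → ℂ) : ℝ × ℝ → ℂ :=
  IFT2 fun p => ((|p.1| ^ s : ℝ) : ℂ) * FT2 f p

/-- Fractional derivative in `x` with complex order `β`. -/
def DxC (β : ℂ) (f : ℝ × ℝ → ℂ) : ℝ × ℝ → ℂ :=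
  IFT2 fun p => (((|p.1| : ℝ) : ℂ) ^ β) * FT2 f p

/-- Inhomogeneous derivative `J_x^s = (1+|D_x|²)^{s/2}`. -/
def Jx (s : ℝ) (f : ℝ × ℝ → ℂ) : ℝ × ℝ → ℂ :=
  IFT2 fun p => (((1 + p.1 ^ 2) ^ (s / 2) : ℝ) : ℂ) * FT2 f p

/-- Real-valued version of `J_x^s`. -/
def JxR (s : ℝ) (f : ℝ × ℝ → ℝ) : ℝ × ℝ → ℝ := fun z =>
  (Jx s (fun w => ((f w : ℝ) : ℂ)) z).re

/-- The unitary group `W_α(t)` with symbol `e^{-it(ξ³+sgn(ξ)|ξ|^α η²)}`. -/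
def Wgrp (α t : ℝ) (f : ℝ × ℝ → ℂ) : ℝ × ℝ → ℂ :=
  IFT2 fun p =>
    Complex.exp (-Complex.I * (t : ℂ) *
      ((p.1 ^ 3 + Real.sign p.1 * |p.1| ^ α * p.2 ^ 2 : ℝ) : ℂ)) * FT2 f p

/-- The operator `ℋ D_x^α` (Hilbert transform composed with fractional derivative in `x`). -/
def HDa (α : ℝ) (f : ℝ × ℝ → ℂ) : ℝ × ℝ → ℂ :=
  IFT2 fun p => (-Complex.I) * ((Real.sign p.1 * |p.1| ^ α : ℝ) : ℂ) * FT2 f p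

/-- Anisotropic Sobolev norm of `H^{s₁,s₂}(ℝ²)`. -/
def HNorm2 (s₁ s₂ : ℝ) (f : ℝ × ℝ → ℂ) : ℝ :=
  Real.sqrt (∫ p : ℝ × ℝ, ((1 + p.1 ^ 2) ^ s₁ + (1 + p.2 ^ 2) ^ s₂) * ‖FT2 f p‖ ^ 2)

/-- Membership in the anisotropic Sobolev space `H^{s₁,s₂}(ℝ²)`. -/
def MemH (s₁ s₂ : ℝ) (f : ℝ × ℝ → ℂ) : Prop :=
  Integrable (fun p : ℝ × ℝ => ((1 + p.1 ^ 2) ^ s₁ + (1 + p.2 ^ 2) ^ s₂) * ‖FT2 f p‖ ^ 2) volume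

/-- Homogeneous anisotropic Sobolev norm. -/
def HdotNorm (s₁ s₂ : ℝ) (f : ℝ × ℝ → ℂ) : ℝ :=
  Real.sqrt (∫ p : ℝ × ℝ, (|p.1| ^ (2 * s₁) + |p.2| ^ (2 * s₂)) * ‖FT2 f p‖ ^ 2)

/-- `u` solves `u_t = u_{xxx} - ℋ D_x^α u_{yy} + u u_x` (complex-valued version). -/
def IsSol (α : ℝ) (u : ℝ → ℝ × ℝ → ℂ) : Prop :=
  ∀ t : ℝ, ∀ z : ℝ × ℝ,
    HasDerivAt (fun s => u s z)
      (iteratedDeriv 3 (fun a => u t (a, z.2)) z.1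
        - HDa α (fun w => iteratedDeriv 2 (fun b => u t (w.1, b)) w.2) z
        + u t z * deriv (fun a => u t (a, z.2)) z.1) t

/-- `u` solves `u_t = u_{xxx} - ℋ D_x^α u_{yy} + u u_x` (real-valued version). -/
def IsSolR (α : ℝ) (u : ℝ → ℝ × ℝ → ℝ) : Prop :=
  ∀ t : ℝ, ∀ z : ℝ × ℝ,
    HasDerivAt (fun s => u s z)
      (iteratedDeriv 3 (fun a => u t (a, z.2)) z.1
        - (HDa α (fun w => ((iteratedDeriv 2 (fun b => u t (w.1, b)) w.2 : ℝ) : ℂ)) z).re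
        + u t z * deriv (fun a => u t (a, z.2)) z.1) t

/-- `u` solves the equation on the time interval `[0,T]` (real-valued version). -/
def IsSolROn (α T : ℝ) (u : ℝ → ℝ × ℝ → ℝ) : Prop :=
  ∀ t ∈ Set.Icc (0 : ℝ) T, ∀ z : ℝ × ℝ,
    HasDerivAt (fun s => u s z)
      (iteratedDeriv 3 (fun a => u t (a, z.2)) z.1
        - (HDa α (fun w => ((iteratedDeriv 2 (fun b => u t (w.1, b)) w.2 : ℝ) : ℂ)) z).re
        + u t z * deriv (fun a => u t (a, z.2)) z.1) t

/-- `w` solves the inhomogeneous linear equation `∂_t w = w_{xxx} - ℋ D_x^α w_{yy} + F` on `[0,T]`. -/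
def IsSolLin (α T : ℝ) (w F : ℝ → ℝ × ℝ → ℂ) : Prop :=
  ∀ t ∈ Set.Icc (0 : ℝ) T, ∀ z : ℝ × ℝ,
    HasDerivAt (fun s => w s z)
      (iteratedDeriv 3 (fun a => w t (a, z.2)) z.1
        - HDa α (fun q => iteratedDeriv 2 (fun b => w t (q.1, b)) q.2) z
        + F t z) t

/-- Integration by parts against an amplitude whose derivative is dominated by `v = V'`. -/
lemma norm_integral_mul_le_of_deriv_le {a b M : ℝ} (hab : a ≤ b)
    {F g g' : ℝ → ℂ} {V v : ℝ → ℝ} (hF : Continuous F)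
    (hbound : ∀ x ∈ Set.Icc a b, ‖∫ s in a..x, F s‖ ≤ M)
    (hg : ∀ x ∈ Set.Icc a b, HasDerivAt g (g' x) x) (hg' : ContinuousOn g' (Set.Icc a b))
    (hV : ∀ x ∈ Set.Icc a b, HasDerivAt V (v x) x) (hv : ContinuousOn v (Set.Icc a b))
    (hgv : ∀ x ∈ Set.Icc a b, ‖g' x‖ ≤ v x) :
    ‖∫ s in a..b, g s * F s‖ ≤ M * (‖g b‖ + (V b - V a)) := by
  have hu : Set.uIcc a b = Set.Icc a b := Set.uIcc_of_le hab
  have hvint : IntervalIntegrable v volume a b :=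
    ContinuousOn.intervalIntegrable (by rwa [hu])
  have hparts : ∫ s in a..b, g s * F s =
      g b * (∫ s in a..b, F s) - g a * (∫ s in a..a, F s) -
        ∫ x in a..b, g' x * ∫ s in a..x, F s := by
    refine intervalIntegral.integral_mul_deriv_eq_deriv_mul (u := g) (v := fun x => ∫ s in a..x, F s)
      (u' := g') (v' := F) (fun x hx => hg x (hu ▸ hx))
      (fun x _ => intervalIntegral.integral_hasDerivAt_right (hF.intervalIntegrable _ _)
        hF.aestronglyMeasurable.stronglyMeasurableAtFilter hF.continuousAt)
      (ContinuousOn.intervalIntegrable (by rwa [hu])) (hF.intervalIntegrable _ _)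
  have hint : ‖∫ x in a..b, g' x * ∫ s in a..x, F s‖ ≤ ∫ x in a..b, v x * M := by
    refine intervalIntegral.norm_integral_le_of_norm_le hab (ae_of_all _ fun x hx => ?_)
      (hvint.mul_const M)
    have hx' : x ∈ Set.Icc a b := Set.Ioc_subset_Icc_self hx
    rw [norm_mul]
    exact mul_le_mul (hgv x hx') (hbound x hx') (norm_nonneg _)
      ((norm_nonneg _).trans (hgv x hx'))
  have hFTC : ∫ x in a..b, v x = V b - V a :=
    intervalIntegral.integral_eq_sub_of_hasDerivAt (fun x hx => hV x (hu ▸ hx)) hvint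
  rw [intervalIntegral.integral_mul_const, hFTC] at hint
  rw [hparts, intervalIntegral.integral_same, mul_zero, sub_zero]
  calc _ ≤ ‖g b * ∫ s in a..b, F s‖ + ‖∫ x in a..b, g' x * ∫ s in a..x, F s‖ := norm_sub_le _ _
    _ ≤ ‖g b‖ * M + (V b - V a) * M := by
        refine add_le_add ?_ hint
        rw [norm_mul]
        exact mul_le_mul_of_nonneg_left (hbound b ⟨hab, le_rfl⟩) (norm_nonneg _)
    _ = _ := by ring

/-- Conjugation symmetry: changing the sign of the phase does not change the modulus of an
oscillatory integral. -/
lemma norm_integral_exp_neg (φ : ℝ → ℝ) (a b : ℝ) :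
    ‖∫ x in a..b, Complex.exp (((-φ x : ℝ) : ℂ) * Complex.I)‖ =
      ‖∫ x in a..b, Complex.exp ((φ x : ℂ) * Complex.I)‖ := by
  rw [← Complex.norm_conj (∫ x in a..b, Complex.exp ((φ x : ℂ) * Complex.I)),
    ← intervalIntegral.intervalIntegral_conj]
  congr 2
  ext x
  rw [← Complex.exp_conj]
  simp

/-- First derivative test of van der Corput, for a phase with increasing positive derivative. -/
lemma vanDerCorput_one_pos {a b l : ℝ} (hab : a ≤ b) (hl : 0 < l) {φ φ₁ φ₂ : ℝ → ℝ}
    (h₁ : ∀ x ∈ Set.Icc a b, HasDerivAt φ (φ₁ x) x)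
    (h₂ : ∀ x ∈ Set.Icc a b, HasDerivAt φ₁ (φ₂ x) x)
    (hc : ContinuousOn φ₂ (Set.Icc a b))
    (hpos : ∀ x ∈ Set.Icc a b, 0 ≤ φ₂ x) (hle : ∀ x ∈ Set.Icc a b, l ≤ φ₁ x) :
    ‖∫ x in a..b, Complex.exp ((φ x : ℂ) * Complex.I)‖ ≤ 4 / l := by
  have hu : Set.uIcc a b = Set.Icc a b := Set.uIcc_of_le hab
  have hne : ∀ x ∈ Set.Icc a b, φ₁ x ≠ 0 := fun x hx => (hl.trans_le (hle x hx)).ne'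
  have hφ₁c : ContinuousOn φ₁ (Set.Icc a b) := fun x hx => (h₂ x hx).continuousAt.continuousWithinAt
  have hφc : ContinuousOn φ (Set.Icc a b) := fun x hx => (h₁ x hx).continuousAt.continuousWithinAt
  set E : ℝ → ℂ := fun x => Complex.exp ((φ x : ℂ) * Complex.I) with hE
  have hEn : ∀ x, ‖E x‖ = 1 := fun x => Complex.norm_exp_ofReal_mul_I _
  have hEc : ContinuousOn E (Set.Icc a b) := by fun_prop
  have hEd : ∀ x ∈ Set.Icc a b, HasDerivAt E (E x * ((φ₁ x : ℂ) * Complex.I)) x := fun x hx =>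
    ((h₁ x hx).ofReal_comp.mul_const Complex.I).cexp
  set w : ℝ → ℝ := fun x => (φ₁ x)⁻¹ with hw
  set w' : ℝ → ℝ := fun x => -φ₂ x / φ₁ x ^ 2 with hw'
  have hwd : ∀ x ∈ Set.Icc a b, HasDerivAt w (w' x) x := fun x hx => (h₂ x hx).inv (hne x hx)
  have hwc : ContinuousOn w' (Set.Icc a b) :=
    hc.neg.div (hφ₁c.pow 2) fun x hx => pow_ne_zero 2 (hne x hx)
  have hw'i : IntervalIntegrable w' volume a b := ContinuousOn.intervalIntegrable (by rwa [hu])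
  have hwle : ∀ x ∈ Set.Icc a b, ‖(w x : ℂ)‖ ≤ 1 / l := fun x hx => by
    rw [Complex.norm_real, Real.norm_eq_abs, abs_of_pos (inv_pos.2 (hl.trans_le (hle x hx))),
      ← one_div]
    exact one_div_le_one_div_of_le hl (hle x hx)
  have hparts : ∫ x in a..b, (w x : ℂ) * (E x * ((φ₁ x : ℂ) * Complex.I)) =
      (w b : ℂ) * E b - (w a : ℂ) * E a - ∫ x in a..b, (w' x : ℂ) * E x := by
    refine intervalIntegral.integral_mul_deriv_eq_deriv_mul
      (fun x hx => (hwd x (hu ▸ hx)).ofReal_comp) (fun x hx => hEd x (hu ▸ hx))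
      (ContinuousOn.intervalIntegrable ?_) (ContinuousOn.intervalIntegrable ?_)
    · rw [hu]; exact Complex.continuous_ofReal.comp_continuousOn hwc
    · rw [hu]; fun_prop
  have hlhs : ∫ x in a..b, (w x : ℂ) * (E x * ((φ₁ x : ℂ) * Complex.I)) =
      (∫ x in a..b, E x) * Complex.I := by
    rw [← intervalIntegral.integral_mul_const]
    refine intervalIntegral.integral_congr fun x hx => ?_
    have h : (φ₁ x : ℂ) ≠ 0 := by exact_mod_cast hne x (hu ▸ hx)
    simp only [hw, Complex.ofReal_inv]
    field_simp
  have hrest : ‖∫ x in a..b, (w' x : ℂ) * E x‖ ≤ 1 / l := by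
    have h : ‖∫ x in a..b, (w' x : ℂ) * E x‖ ≤ ∫ x in a..b, -w' x := by
      refine intervalIntegral.norm_integral_le_of_norm_le hab (ae_of_all _ fun x hx => ?_)
        hw'i.neg
      have hx' : x ∈ Set.Icc a b := Set.Ioc_subset_Icc_self hx
      rw [norm_mul, hEn, mul_one, Complex.norm_real, Real.norm_eq_abs, abs_of_nonpos]
      exact div_nonpos_of_nonpos_of_nonneg (neg_nonpos.2 (hpos x hx')) (sq_nonneg _)
    rw [intervalIntegral.integral_neg, intervalIntegral.integral_eq_sub_of_hasDerivAt
      (fun x hx => hwd x (hu ▸ hx)) hw'i] at h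
    have ha := hwle a ⟨le_rfl, hab⟩
    rw [Complex.norm_real] at ha
    have hb : 0 < w b := inv_pos.2 (hl.trans_le (hle b ⟨hab, le_rfl⟩))
    linarith [le_abs_self (w a), Real.norm_eq_abs (w a)]
  have hnorm : ‖∫ x in a..b, E x‖ = ‖(∫ x in a..b, E x) * Complex.I‖ := by simp
  rw [hnorm, ← hlhs, hparts]
  have h1 : ‖(w b : ℂ) * E b‖ ≤ 1 / l := by
    rw [norm_mul, hEn, mul_one]; exact hwle b ⟨hab, le_rfl⟩
  have h2 : ‖(w a : ℂ) * E a‖ ≤ 1 / l := by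
    rw [norm_mul, hEn, mul_one]; exact hwle a ⟨le_rfl, hab⟩
  have h3 : (4 : ℝ) / l = 4 * (1 / l) := by ring
  have h4 : 0 < 1 / l := by positivity
  linarith [norm_sub_le ((w b : ℂ) * E b - (w a : ℂ) * E a) (∫ x in a..b, (w' x : ℂ) * E x),
    norm_sub_le ((w b : ℂ) * E b) ((w a : ℂ) * E a)]

/-- Splitting at the zero of a function with slope at least `l`. -/
lemma norm_integral_le_of_slope {a b l d B : ℝ} (hab : a ≤ b) (hl : 0 < l) (hd : 0 < d)
    (hB : 0 ≤ B) {F : ℝ → ℂ} {f : ℝ → ℝ} (hF : ∀ x, ‖F x‖ ≤ 1)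
    (hFi : IntervalIntegrable F volume a b) (hfc : ContinuousOn f (Set.Icc a b))
    (hf : ∀ x ∈ Set.Icc a b, ∀ y ∈ Set.Icc a b, x ≤ y → l * (y - x) ≤ f y - f x)
    (hpos : ∀ a' b', a ≤ a' → a' ≤ b' → b' ≤ b → (∀ x ∈ Set.Icc a' b', l * d ≤ f x) →
      ‖∫ x in a'..b', F x‖ ≤ B)
    (hneg : ∀ a' b', a ≤ a' → a' ≤ b' → b' ≤ b → (∀ x ∈ Set.Icc a' b', f x ≤ -(l * d)) →
      ‖∫ x in a'..b', F x‖ ≤ B) :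
    ‖∫ x in a..b, F x‖ ≤ 2 * d + 2 * B := by
  obtain ⟨c, hc, hcr, hcl⟩ : ∃ c ∈ Set.Icc a b, (∀ x ∈ Set.Icc a b, c < x → 0 ≤ f c) ∧
      (∀ x ∈ Set.Icc a b, x < c → f c ≤ 0) := by
    by_cases ha : 0 ≤ f a
    · exact ⟨a, ⟨le_rfl, hab⟩, fun _ _ _ => ha, fun x hx h => absurd hx.1 (not_le.2 h)⟩
    by_cases hb : f b ≤ 0
    · exact ⟨b, ⟨hab, le_rfl⟩, fun x hx h => absurd hx.2 (not_le.2 h), fun _ _ _ => hb⟩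
    obtain ⟨c, hc, hc0⟩ := intermediate_value_Icc hab hfc ⟨(not_le.1 ha).le, (not_le.1 hb).le⟩
    exact ⟨c, hc, fun _ _ _ => hc0.ge, fun _ _ _ => hc0.le⟩
  set p := max a (c - d) with hp
  set q := min b (c + d) with hq
  have hap : a ≤ p := le_max_left _ _
  have hpc : p ≤ c := max_le hc.1 (by linarith)
  have hcq : c ≤ q := le_min hc.2 (by linarith)
  have hqb : q ≤ b := min_le_left _ _
  have hsub : ∀ {u v}, a ≤ u → u ≤ v → v ≤ b → IntervalIntegrable F volume u v :=
    fun {u v} hau huv hvb => hFi.mono_set (by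
      rw [Set.uIcc_of_le huv, Set.uIcc_of_le hab]; exact Set.Icc_subset_Icc hau hvb)
  have hI1 : ‖∫ x in a..p, F x‖ ≤ B := by
    rcases le_or_gt (c - d) a with h | h
    · rw [hp, max_eq_left h, intervalIntegral.integral_same, norm_zero]; exact hB
    · refine hneg a p le_rfl hap (hpc.trans hc.2) fun x hx => ?_
      have hpe : p = c - d := max_eq_right h.le
      have hx' : x ∈ Set.Icc a b := ⟨hx.1, hx.2.trans (hpc.trans hc.2)⟩
      have h1 := hf x hx' c hc (hx.2.trans hpc)
      have h2 := hcl x hx' (by linarith [hx.2])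
      have h3 : l * d ≤ l * (c - x) := mul_le_mul_of_nonneg_left (by linarith [hx.2]) hl.le
      linarith
  have hI3 : ‖∫ x in q..b, F x‖ ≤ B := by
    rcases le_or_gt b (c + d) with h | h
    · rw [hq, min_eq_left h, intervalIntegral.integral_same, norm_zero]; exact hB
    · refine hpos q b (hc.1.trans hcq) hqb le_rfl fun x hx => ?_
      have hqe : q = c + d := min_eq_right h.le
      have hx' : x ∈ Set.Icc a b := ⟨(hc.1.trans hcq).trans hx.1, hx.2⟩
      have h1 := hf c hc x hx' (hcq.trans hx.1)
      have h2 := hcr x hx' (by linarith [hx.1])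
      have h3 : l * d ≤ l * (x - c) := mul_le_mul_of_nonneg_left (by linarith [hx.1]) hl.le
      linarith
  have hI2 : ‖∫ x in p..q, F x‖ ≤ 2 * d := by
    have h := intervalIntegral.norm_integral_le_of_norm_le_const (a := p) (b := q)
      (C := 1) (f := F) fun x _ => hF x
    rw [abs_of_nonneg (by linarith)] at h
    linarith [min_le_right b (c + d), le_max_right a (c - d)]
  have hadd : ∫ x in a..b, F x = (∫ x in a..p, F x) + (∫ x in p..q, F x) + ∫ x in q..b, F x := by
    rw [intervalIntegral.integral_add_adjacent_intervals, intervalIntegral.integral_add_adjacent_intervals]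
    · exact hsub le_rfl (hap.trans (hpc.trans hcq)) hqb
    · exact hsub (hap.trans (hpc.trans hcq)) hqb le_rfl
    · exact hsub le_rfl hap (hpc.trans hc.2)
    · exact hsub hap (hpc.trans hcq) hqb
  rw [hadd]
  linarith [norm_add₃_le (a := ∫ x in a..p, F x) (b := ∫ x in p..q, F x) (c := ∫ x in q..b, F x)]

/-- A lower bound on the derivative is a lower bound on the slopes. -/
lemma mul_sub_le_sub_of_le_deriv {a b l : ℝ} {f f' : ℝ → ℝ}
    (hf : ∀ x ∈ Set.Icc a b, HasDerivAt f (f' x) x) (hle : ∀ x ∈ Set.Icc a b, l ≤ f' x) :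
    ∀ x ∈ Set.Icc a b, ∀ y ∈ Set.Icc a b, x ≤ y → l * (y - x) ≤ f y - f x := by
  refine (convex_Icc a b).mul_sub_le_image_sub_of_le_deriv
    (fun x hx => (hf x hx).continuousAt.continuousWithinAt)
    (fun x hx => (hf x (interior_subset hx)).differentiableAt.differentiableWithinAt)
    fun x hx => ?_
  rw [(hf x (interior_subset hx)).deriv]
  exact hle x (interior_subset hx)

/-- Second derivative test of van der Corput. -/
lemma vanDerCorput_two {a b l : ℝ} (hab : a ≤ b) (hl : 0 < l) {φ φ₁ φ₂ : ℝ → ℝ}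
    (h₁ : ∀ x ∈ Set.Icc a b, HasDerivAt φ (φ₁ x) x)
    (h₂ : ∀ x ∈ Set.Icc a b, HasDerivAt φ₁ (φ₂ x) x)
    (hc : ContinuousOn φ₂ (Set.Icc a b)) (hle : ∀ x ∈ Set.Icc a b, l ^ 2 ≤ φ₂ x) :
    ‖∫ x in a..b, Complex.exp ((φ x : ℂ) * Complex.I)‖ ≤ 10 / l := by
  have hφc : ContinuousOn φ (Set.Icc a b) := fun x hx => (h₁ x hx).continuousAt.continuousWithinAt
  have hld : l ^ 2 * (1 / l) = l := by field_simp
  have key := norm_integral_le_of_slope (F := fun x => Complex.exp ((φ x : ℂ) * Complex.I))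
    (f := φ₁) (l := l ^ 2) (d := 1 / l) (B := 4 / l) hab (by positivity) (by positivity)
    (by positivity) (fun x => (Complex.norm_exp_ofReal_mul_I _).le)
    (ContinuousOn.intervalIntegrable (by rw [Set.uIcc_of_le hab]; fun_prop))
    (fun x hx => (h₂ x hx).continuousAt.continuousWithinAt) (mul_sub_le_sub_of_le_deriv h₂ hle)
    ?_ ?_
  · refine key.trans (le_of_eq ?_); ring
  · intro a' b' ha hab' hb h
    have hs : Set.Icc a' b' ⊆ Set.Icc a b := Set.Icc_subset_Icc ha hb
    rw [hld] at h
    exact vanDerCorput_one_pos hab' hl (fun x hx => h₁ x (hs hx)) (fun x hx => h₂ x (hs hx))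
      (hc.mono hs) (fun x hx => (sq_nonneg l).trans (hle x (hs hx))) h
  · intro a' b' ha hab' hb h
    rw [hld] at h
    have hs : Set.Icc (-b') (-a') ⊆ Neg.neg ⁻¹' Set.Icc a b := fun x hx =>
      ⟨by linarith [hx.2], by linarith [hx.1]⟩
    have hrefl := intervalIntegral.integral_comp_neg (a := -b') (b := -a')
      (fun x => Complex.exp ((φ x : ℂ) * Complex.I))
    rw [neg_neg, neg_neg] at hrefl
    rw [← hrefl]
    refine vanDerCorput_one_pos (φ := fun x => φ (-x)) (φ₁ := fun x => -φ₁ (-x))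
      (φ₂ := fun x => φ₂ (-x)) (by linarith) hl (fun x hx => ?_) (fun x hx => ?_) ?_
      (fun x hx => (sq_nonneg l).trans (hle (-x) (hs hx))) (fun x hx => ?_)
    · simpa [Function.comp_def] using (h₁ (-x) (hs hx)).scomp x (hasDerivAt_neg x)
    · simpa [Function.comp_def] using ((h₂ (-x) (hs hx)).scomp x (hasDerivAt_neg x)).fun_neg
    · exact hc.comp continuousOn_neg hs
    · have := h (-x) ⟨by linarith [hx.2], by linarith [hx.1]⟩
      linarith

/-- Third derivative test of van der Corput. -/
lemma vanDerCorput_three {a b l : ℝ} (hab : a ≤ b) (hl : 0 < l) {φ φ₁ φ₂ φ₃ : ℝ → ℝ}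
    (h₁ : ∀ x ∈ Set.Icc a b, HasDerivAt φ (φ₁ x) x)
    (h₂ : ∀ x ∈ Set.Icc a b, HasDerivAt φ₁ (φ₂ x) x)
    (h₃ : ∀ x ∈ Set.Icc a b, HasDerivAt φ₂ (φ₃ x) x)
    (hle : ∀ x ∈ Set.Icc a b, l ^ 3 ≤ φ₃ x) :
    ‖∫ x in a..b, Complex.exp ((φ x : ℂ) * Complex.I)‖ ≤ 22 / l := by
  have hφc : ContinuousOn φ (Set.Icc a b) := fun x hx => (h₁ x hx).continuousAt.continuousWithinAt
  have hc : ContinuousOn φ₂ (Set.Icc a b) := fun x hx => (h₃ x hx).continuousAt.continuousWithinAt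
  have hld : l ^ 3 * (1 / l) = l ^ 2 := by field_simp
  have key := norm_integral_le_of_slope (F := fun x => Complex.exp ((φ x : ℂ) * Complex.I))
    (f := φ₂) (l := l ^ 3) (d := 1 / l) (B := 10 / l) hab (by positivity) (by positivity)
    (by positivity) (fun x => (Complex.norm_exp_ofReal_mul_I _).le)
    (ContinuousOn.intervalIntegrable (by rw [Set.uIcc_of_le hab]; fun_prop))
    hc (mul_sub_le_sub_of_le_deriv h₃ hle) ?_ ?_
  · refine key.trans (le_of_eq ?_); ring
  · intro a' b' ha hab' hb h
    have hs : Set.Icc a' b' ⊆ Set.Icc a b := Set.Icc_subset_Icc ha hb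
    rw [hld] at h
    exact vanDerCorput_two hab' hl (fun x hx => h₁ x (hs hx)) (fun x hx => h₂ x (hs hx))
      (hc.mono hs) h
  · intro a' b' ha hab' hb h
    have hs : Set.Icc a' b' ⊆ Set.Icc a b := Set.Icc_subset_Icc ha hb
    rw [hld] at h
    rw [← norm_integral_exp_neg]
    refine vanDerCorput_two (φ₁ := fun x => -φ₁ x) (φ₂ := fun x => -φ₂ x) hab' hl
      (fun x hx => (h₁ x (hs hx)).neg) (fun x hx => (h₂ x (hs hx)).neg) (hc.mono hs).neg
      fun x hx => ?_
    linarith [h x hx]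

/-- Local version of `norm_integral_mul_le_of_deriv_le`: the oscillating factor only needs to be
continuous on the interval of integration. -/
lemma norm_integral_mul_le_of_continuousOn {a b M : ℝ} (hab : a ≤ b)
    {F g g' : ℝ → ℂ} {V v : ℝ → ℝ} (hF : ContinuousOn F (Set.Icc a b))
    (hbound : ∀ x ∈ Set.Icc a b, ‖∫ s in a..x, F s‖ ≤ M)
    (hg : ∀ x ∈ Set.Icc a b, HasDerivAt g (g' x) x) (hg' : ContinuousOn g' (Set.Icc a b))
    (hV : ∀ x ∈ Set.Icc a b, HasDerivAt V (v x) x) (hv : ContinuousOn v (Set.Icc a b))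
    (hgv : ∀ x ∈ Set.Icc a b, ‖g' x‖ ≤ v x) :
    ‖∫ s in a..b, g s * F s‖ ≤ M * (‖g b‖ + (V b - V a)) := by
  have hext : ∀ x ∈ Set.Icc a b, max a (min b x) = x := fun x hx => by
    rw [min_eq_right hx.2, max_eq_right hx.1]
  have hFc : Continuous fun x => F (max a (min b x)) :=
    hF.comp_continuous (by fun_prop) fun x => ⟨le_max_left _ _, max_le hab (min_le_left _ _)⟩
  have key := norm_integral_mul_le_of_deriv_le (M := M) hab hFc (fun x hx => ?_) hg hg' hV hv hgv
  · convert key using 2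
    refine intervalIntegral.integral_congr fun x hx => ?_
    rw [Set.uIcc_of_le hab] at hx
    simp only [hext x hx]
  · convert hbound x hx using 2
    refine intervalIntegral.integral_congr fun y hy => ?_
    rw [Set.uIcc_of_le hx.1] at hy
    simp only [hext y ⟨hy.1, hy.2.trans hx.2⟩]

/-- The model phase, cubic in frequency with a correction `x ^ (-α)` coming from the transverse
variable. -/
def dispPhase (α X T k x : ℝ) : ℝ := X * x + T * (x ^ 3 - k * x ^ (-α))

lemma dispPhase_neg (α X T k x : ℝ) : dispPhase α (-X) (-T) k x = -dispPhase α X T k x := by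
  simp only [dispPhase]; ring

lemma continuousOn_dispPhase (α X T k : ℝ) {a b : ℝ} (ha : 0 < a) :
    ContinuousOn (dispPhase α X T k) (Set.Icc a b) := by
  have h : ContinuousOn (fun x : ℝ => x ^ (-α)) (Set.Icc a b) := fun x hx =>
    (Real.continuousAt_rpow_const x (-α) (Or.inl (ha.trans_le hx.1).ne')).continuousWithinAt
  unfold dispPhase
  fun_prop

/-- Decay of the model oscillatory integral away from zero frequency, positive `T`. -/
lemma norm_integral_dispPhase_le_of_pos {α : ℝ} (hα1 : -1 ≤ α) {X k L a b : ℝ}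
    (hk : 0 ≤ k) (hL : 0 < L) (ha : 1 / L ≤ a) (hab : a ≤ b) :
    ‖∫ x in a..b, Complex.exp ((dispPhase α X (L ^ 3) k x : ℂ) * Complex.I)‖ ≤ 22 / L := by
  have ha0 : 0 < a := lt_of_lt_of_le (by positivity) ha
  have hx0 : ∀ x ∈ Set.Icc a b, 0 < x := fun x hx => ha0.trans_le hx.1
  have hpow : ∀ (p : ℝ), ∀ x ∈ Set.Icc a b, HasDerivAt (fun y : ℝ => y ^ p) (p * x ^ (p - 1)) x :=
    fun p x hx => Real.hasDerivAt_rpow_const (Or.inl (hx0 x hx).ne')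
  set φ₁ : ℝ → ℝ := fun x => X + L ^ 3 * (3 * x ^ 2 - k * (-α * x ^ (-α - 1))) with hφ₁
  set φ₂ : ℝ → ℝ := fun x => L ^ 3 * (6 * x - k * (-α * ((-α - 1) * x ^ (-α - 1 - 1)))) with hφ₂
  set φ₃ : ℝ → ℝ := fun x =>
    L ^ 3 * (6 - k * (-α * ((-α - 1) * ((-α - 1 - 1) * x ^ (-α - 1 - 1 - 1))))) with hφ₃
  have h₁ : ∀ x ∈ Set.Icc a b, HasDerivAt (dispPhase α X (L ^ 3) k) (φ₁ x) x := fun x hx => by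
    refine (((hasDerivAt_id x).const_mul X).add ((((hasDerivAt_pow 3 x)).sub
      ((hpow (-α) x hx).const_mul k)).const_mul (L ^ 3))).congr_deriv ?_
    simp [hφ₁]
  have h₂ : ∀ x ∈ Set.Icc a b, HasDerivAt φ₁ (φ₂ x) x := fun x hx => by
    refine ((((((hasDerivAt_pow 2 x)).const_mul 3).sub
      (((hpow (-α - 1) x hx).const_mul (-α)).const_mul k)).const_mul (L ^ 3)).const_add X).congr_deriv ?_
    simp only [hφ₂]; push_cast; ring
  have h₃ : ∀ x ∈ Set.Icc a b, HasDerivAt φ₂ (φ₃ x) x := fun x hx => by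
    refine ((((hasDerivAt_id x).const_mul 6).sub
      ((((hpow (-α - 1 - 1) x hx).const_mul (-α - 1)).const_mul (-α)).const_mul k)).const_mul
        (L ^ 3)).congr_deriv ?_
    simp [hφ₃]
  rcases le_total 0 α with hα | hα
  · refine vanDerCorput_three hab hL h₁ h₂ h₃ fun x hx => ?_
    have hp : 0 ≤ x ^ (-α - 1 - 1 - 1) := Real.rpow_nonneg (hx0 x hx).le _
    have : 0 ≤ k * (α * ((α + 1) * ((α + 2) * x ^ (-α - 1 - 1 - 1)))) := by positivity
    have hL3 : 0 < L ^ 3 := by positivity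
    calc L ^ 3 = L ^ 3 * 1 := by ring
      _ ≤ φ₃ x := mul_le_mul_of_nonneg_left (by linarith) hL3.le
  · have hc : ContinuousOn φ₂ (Set.Icc a b) := fun x hx =>
      (h₃ x hx).continuousAt.continuousWithinAt
    refine (vanDerCorput_two hab hL h₁ h₂ hc fun x hx => ?_).trans
      (div_le_div_of_nonneg_right (by norm_num) hL.le)
    have hp : 0 ≤ x ^ (-α - 1 - 1) := Real.rpow_nonneg (hx0 x hx).le _
    have h0 : 0 ≤ k * (-α * ((α + 1) * x ^ (-α - 1 - 1))) :=
      mul_nonneg hk (mul_nonneg (by linarith) (mul_nonneg (by linarith) hp))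
    have hL3 : 0 < L ^ 3 := by positivity
    have hxL : 1 / L ≤ x := ha.trans hx.1
    have hx0' := hx0 x hx
    calc L ^ 2 = L ^ 3 * (1 / L) := by field_simp
      _ ≤ φ₂ x := mul_le_mul_of_nonneg_left (by linarith) hL3.le

lemma norm_integral_dispPhase_le {α : ℝ} (hα1 : -1 ≤ α) {X T k L a b : ℝ}
    (hk : 0 ≤ k) (hL : 0 < L) (hT : |T| = L ^ 3) (ha : 1 / L ≤ a) (hab : a ≤ b) :
    ‖∫ x in a..b, Complex.exp ((dispPhase α X T k x : ℂ) * Complex.I)‖ ≤ 22 / L := by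
  rcases abs_choice T with h | h
  · rw [show T = L ^ 3 by rw [← hT, h]]
    exact norm_integral_dispPhase_le_of_pos hα1 hk hL ha hab
  · rw [← norm_integral_exp_neg]
    simp only [← dispPhase_neg]
    rw [show -T = L ^ 3 by rw [← hT, h]]
    exact norm_integral_dispPhase_le_of_pos hα1 hk hL ha hab

/-- Inserting the monotone damping factor `exp (-d x ^ (-α))`. -/
lemma norm_integral_damped_dispPhase_le {α : ℝ} (hα1 : -1 ≤ α) {X T k d L a b : ℝ}
    (hk : 0 ≤ k) (hd : 0 ≤ d) (hL : 0 < L) (hT : |T| = L ^ 3) (ha : 1 / L ≤ a) (hab : a ≤ b) :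
    ‖∫ x in a..b, (Real.exp (-d * x ^ (-α)) : ℂ) *
      Complex.exp ((dispPhase α X T k x : ℂ) * Complex.I)‖ ≤ 44 / L := by
  have ha0 : 0 < a := lt_of_lt_of_le (by positivity) ha
  have hx0 : ∀ x ∈ Set.Icc a b, 0 < x := fun x hx => ha0.trans_le hx.1
  set D : ℝ → ℝ := fun x => Real.exp (-d * x ^ (-α)) with hD
  set D' : ℝ → ℝ := fun x => Real.exp (-d * x ^ (-α)) * (-d * (-α * x ^ (-α - 1))) with hD'
  have hDd : ∀ x ∈ Set.Icc a b, HasDerivAt D (D' x) x := fun x hx =>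
    ((Real.hasDerivAt_rpow_const (Or.inl (hx0 x hx).ne')).const_mul (-d)).exp
  have hpc : ∀ p : ℝ, ContinuousOn (fun x : ℝ => x ^ p) (Set.Icc a b) := fun p x hx =>
    (Real.continuousAt_rpow_const x p (Or.inl (hx0 x hx).ne')).continuousWithinAt
  have hDc : ContinuousOn D' (Set.Icc a b) := by
    have h1 := hpc (-α)
    have h2 := hpc (-α - 1)
    fun_prop
  have hDle : ∀ x, 0 < x → D x ∈ Set.Icc (0 : ℝ) 1 := fun x hx =>
    ⟨(Real.exp_pos _).le, Real.exp_le_one_iff.2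
      (mul_nonpos_of_nonpos_of_nonneg (by linarith) (Real.rpow_nonneg hx.le _))⟩
  have hcont := continuousOn_dispPhase α X T k (b := b) ha0
  have hEc : ContinuousOn (fun x => Complex.exp ((dispPhase α X T k x : ℂ) * Complex.I))
      (Set.Icc a b) := by fun_prop
  have hDa := hDle a ha0
  have hDb := hDle b (ha0.trans_le hab)
  have hb1 : ‖(D b : ℂ)‖ ≤ 1 := by
    rw [Complex.norm_real, Real.norm_eq_abs, abs_of_nonneg hDb.1]; exact hDb.2
  have hgoal : ∀ V : ℝ, V ≤ 1 → 22 / L * (‖(D b : ℂ)‖ + V) ≤ 44 / L := fun V hV => by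
    have : 22 / L * (‖(D b : ℂ)‖ + V) ≤ 22 / L * 2 :=
      mul_le_mul_of_nonneg_left (by linarith) (by positivity)
    exact this.trans (le_of_eq (by ring))
  have hcs : ContinuousOn (fun x => (D' x : ℂ)) (Set.Icc a b) :=
    Complex.continuous_ofReal.comp_continuousOn hDc
  have hbd : ∀ x ∈ Set.Icc a b,
      ‖∫ s in a..x, Complex.exp ((dispPhase α X T k s : ℂ) * Complex.I)‖ ≤ 22 / L :=
    fun x hx => norm_integral_dispPhase_le hα1 hk hL hT ha hx.1
  rcases le_total 0 α with hα | hα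
  · refine (norm_integral_mul_le_of_continuousOn hab hEc hbd
      (g := fun x => (D x : ℂ)) (g' := fun x => (D' x : ℂ)) (V := D) (v := D')
      (fun x hx => (hDd x hx).ofReal_comp) hcs hDd hDc fun x hx => ?_).trans
        (hgoal _ (by linarith [hDa.1, hDb.2]))
    rw [Complex.norm_real, Real.norm_eq_abs, abs_of_nonneg]
    have h := Real.rpow_nonneg (hx0 x hx).le (-α - 1)
    have : 0 ≤ d * (α * x ^ (-α - 1)) := by positivity
    exact mul_nonneg (Real.exp_pos _).le (by linarith)
  · refine (norm_integral_mul_le_of_continuousOn hab hEc hbd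
      (g := fun x => (D x : ℂ)) (g' := fun x => (D' x : ℂ)) (V := fun x => -D x)
      (v := fun x => -D' x) (fun x hx => (hDd x hx).ofReal_comp) hcs
      (fun x hx => (hDd x hx).neg) hDc.neg fun x hx => ?_).trans
        (hgoal _ (by linarith [hDb.1, hDa.2]))
    rw [Complex.norm_real, Real.norm_eq_abs, abs_of_nonpos]
    have h := Real.rpow_nonneg (hx0 x hx).le (-α - 1)
    have : 0 ≤ d * (-α * x ^ (-α - 1)) := mul_nonneg hd (mul_nonneg (by linarith) h)
    exact mul_nonpos_of_nonneg_of_nonpos (Real.exp_pos _).le (by linarith)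

/-- The damped oscillating factor of the model integral. -/
def dispWave (α X T k d x : ℝ) : ℂ :=
  (Real.exp (-d * x ^ (-α)) : ℂ) * Complex.exp ((dispPhase α X T k x : ℂ) * Complex.I)

lemma norm_dispWave_le {α X T k d x : ℝ} (hd : 0 ≤ d) (hx : 0 < x) :
    ‖dispWave α X T k d x‖ ≤ 1 := by
  rw [dispWave, norm_mul, Complex.norm_exp_ofReal_mul_I, mul_one, Complex.norm_real,
    Real.norm_eq_abs, abs_of_pos (Real.exp_pos _)]
  exact Real.exp_le_one_iff.2
      (mul_nonpos_of_nonpos_of_nonneg (by linarith) (Real.rpow_nonneg hx.le _))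

lemma continuousOn_dispWave (α X T k d : ℝ) {a b : ℝ} (ha : 0 < a) :
    ContinuousOn (dispWave α X T k d) (Set.Icc a b) := by
  have h : ContinuousOn (fun x : ℝ => x ^ (-α)) (Set.Icc a b) := fun x hx =>
    (Real.continuousAt_rpow_const x (-α) (Or.inl (ha.trans_le hx.1).ne')).continuousWithinAt
  have h2 := continuousOn_dispPhase α X T k (b := b) ha
  unfold dispWave
  fun_prop

/-- High-frequency part of the amplitude-weighted model integral. -/
lemma norm_integral_cpow_dispWave_high {α : ℝ} (hα1 : -1 ≤ α) {κ : ℂ} (hκ0 : κ.re < 0)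
    {X T k d L a b : ℝ}
    (hk : 0 ≤ k) (hd : 0 ≤ d) (hL : 0 < L) (hT : |T| = L ^ 3) (ha : 1 / L ≤ a) (hab : a ≤ b) :
    ‖∫ x in a..b, (x : ℂ) ^ κ * dispWave α X T k d x‖ ≤
      44 * (1 + ‖κ‖ / (-κ.re)) * (1 / L) ^ (κ.re + 1) := by
  have hL1 : 0 < 1 / L := by positivity
  have ha0 : 0 < a := lt_of_lt_of_le hL1 ha
  have hx0 : ∀ x ∈ Set.Icc a b, 0 < x := fun x hx => ha0.trans_le hx.1
  have hκ : κ ≠ 0 := by rintro rfl; simp at hκ0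
  have hpc : ∀ p : ℝ, ContinuousOn (fun x : ℝ => x ^ p) (Set.Icc a b) := fun p x hx =>
    (Real.continuousAt_rpow_const x p (Or.inl (hx0 x hx).ne')).continuousWithinAt
  have key := norm_integral_mul_le_of_continuousOn hab
    (continuousOn_dispWave α X T k d (b := b) ha0) (M := 44 / L)
    (fun x hx => norm_integral_damped_dispPhase_le hα1 hk hd hL hT ha hx.1)
    (g := fun x => (x : ℂ) ^ κ) (g' := fun x => κ * (x : ℂ) ^ (κ - 1))
    (V := fun x => ‖κ‖ / κ.re * x ^ κ.re)
    (v := fun x => ‖κ‖ / κ.re * (κ.re * x ^ (κ.re - 1)))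
    (fun x hx => ?_) (fun x hx => ?_)
    (fun x hx => (Real.hasDerivAt_rpow_const (Or.inl (hx0 x hx).ne')).const_mul _)
    ?_ (fun x hx => ?_)
  · refine key.trans ?_
    have hb0 := ha0.trans_le hab
    have h1 : ‖(b : ℂ) ^ κ‖ ≤ (1 / L) ^ κ.re := by
      rw [Complex.norm_cpow_eq_rpow_re_of_pos hb0]
      exact Real.rpow_le_rpow_of_nonpos hL1 (ha.trans hab) hκ0.le
    have h2 : a ^ κ.re ≤ (1 / L) ^ κ.re := Real.rpow_le_rpow_of_nonpos hL1 ha hκ0.le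
    have h3 : 0 ≤ b ^ κ.re := Real.rpow_nonneg hb0.le _
    have h4 : 0 ≤ ‖κ‖ / (-κ.re) := div_nonneg (norm_nonneg _) (by linarith)
    have h5 : ‖κ‖ / κ.re = -(‖κ‖ / (-κ.re)) := by rw [div_neg, neg_neg]
    rw [Real.rpow_add hL1, Real.rpow_one, h5]
    have h6 : ‖κ‖ / (-κ.re) * a ^ κ.re ≤ ‖κ‖ / (-κ.re) * (1 / L) ^ κ.re :=
      mul_le_mul_of_nonneg_left h2 h4
    have h7 : 0 ≤ ‖κ‖ / (-κ.re) * b ^ κ.re := mul_nonneg h4 h3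
    calc _ ≤ 44 / L * ((1 / L) ^ κ.re + ‖κ‖ / (-κ.re) * (1 / L) ^ κ.re) :=
          mul_le_mul_of_nonneg_left (by linarith) (by positivity)
      _ = _ := by ring
  · exact hasDerivAt_ofReal_cpow_const (hx0 x hx).ne' hκ
  · refine ContinuousAt.continuousWithinAt ?_
    have h := Complex.continuousAt_ofReal_cpow_const x (κ - 1) (Or.inr (hx0 x hx).ne')
    exact h.const_mul κ
  · have := hpc (κ.re - 1)
    fun_prop
  · rw [norm_mul, Complex.norm_cpow_eq_rpow_re_of_pos (hx0 x hx), ← mul_assoc,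
      div_mul_cancel₀ _ hκ0.ne]
    simp

/-- Low-frequency part of the amplitude-weighted model integral. -/
lemma norm_integral_cpow_dispWave_low {α : ℝ} {κ : ℂ} (hκ1 : -1 < κ.re) {X T k d δ a b : ℝ}
    (hd : 0 ≤ d) (ha : 0 < a) (hab : a ≤ b) (hb : b ≤ δ) :
    ‖∫ x in a..b, (x : ℂ) ^ κ * dispWave α X T k d x‖ ≤ 1 / (κ.re + 1) * δ ^ (κ.re + 1) := by
  have h : ‖∫ x in a..b, (x : ℂ) ^ κ * dispWave α X T k d x‖ ≤ ∫ x in a..b, x ^ κ.re := by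
    refine intervalIntegral.norm_integral_le_of_norm_le hab (ae_of_all _ fun x hx => ?_)
      (intervalIntegral.intervalIntegrable_rpow' hκ1)
    have hx0 : 0 < x := ha.trans hx.1
    rw [norm_mul, Complex.norm_cpow_eq_rpow_re_of_pos hx0]
    exact mul_le_of_le_one_right (Real.rpow_nonneg hx0.le _) (norm_dispWave_le hd hx0)
  refine h.trans ?_
  rw [integral_rpow (Or.inl hκ1), div_eq_mul_one_div, mul_comm]
  have h1 : 0 < κ.re + 1 := by linarith
  refine mul_le_mul_of_nonneg_left ?_ (by positivity)
  have h2 : b ^ (κ.re + 1) ≤ δ ^ (κ.re + 1) := Real.rpow_le_rpow (ha.le.trans hab) hb h1.le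
  linarith [Real.rpow_nonneg ha.le (κ.re + 1)]

/-- Constant in the one-dimensional oscillatory estimate. -/
def dispConst (κ : ℂ) : ℝ := 44 * (1 + ‖κ‖ / (-κ.re)) + 1 / (κ.re + 1)

lemma norm_integral_cpow_dispWave_le {α : ℝ} (hα1 : -1 ≤ α) {κ : ℂ} (hκ1 : -1 < κ.re)
    (hκ0 : κ.re < 0) {X T k d L a b : ℝ}
    (hk : 0 ≤ k) (hd : 0 ≤ d) (hL : 0 < L) (hT : |T| = L ^ 3) (ha : 0 < a) (hab : a ≤ b) :
    ‖∫ x in a..b, (x : ℂ) ^ κ * dispWave α X T k d x‖ ≤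
      dispConst κ * (1 / L) ^ (κ.re + 1) := by
  have h1 : 0 < κ.re + 1 := by linarith
  have h2 : 0 < -κ.re := by linarith
  have hδ : 0 < (1 / L) ^ (κ.re + 1) := Real.rpow_pos_of_pos (by positivity) _
  have hH : 0 ≤ 44 * (1 + ‖κ‖ / (-κ.re)) * (1 / L) ^ (κ.re + 1) := by positivity
  have hLo : 0 ≤ 1 / (κ.re + 1) * (1 / L) ^ (κ.re + 1) := by positivity
  rw [dispConst, add_mul]
  rcases le_total b (1 / L) with hb | hb
  · linarith [norm_integral_cpow_dispWave_low (α := α) hκ1 (X := X) (T := T) (k := k) hd ha hab hb]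
  rcases le_total (1 / L) a with hc | hc
  · linarith [norm_integral_cpow_dispWave_high hα1 hκ0 (X := X) hk hd hL hT hc hab]
  have hi : ∀ u v, 0 < u → u ≤ v → IntervalIntegrable
      (fun x : ℝ => (x : ℂ) ^ κ * dispWave α X T k d x) volume u v := fun u v hu huv => by
    refine ContinuousOn.intervalIntegrable ?_
    rw [Set.uIcc_of_le huv]
    refine ContinuousOn.mul (fun x hx => ?_) (continuousOn_dispWave α X T k d hu)
    exact (Complex.continuousAt_ofReal_cpow_const x κ
      (Or.inr (hu.trans_le hx.1).ne')).continuousWithinAt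
  rw [← intervalIntegral.integral_add_adjacent_intervals (hi a (1 / L) ha hc)
    (hi (1 / L) b (by positivity) hb)]
  have h3 := norm_integral_cpow_dispWave_low (α := α) hκ1 (X := X) (T := T) (k := k) hd ha hc le_rfl
  have h4 := norm_integral_cpow_dispWave_high hα1 hκ0 (X := X) hk hd hL hT le_rfl hb
  refine (norm_add_le _ _).trans ?_
  linarith

/-- The plane wave with frequency `p` evaluated at `x`. -/
def planeWave (x p : ℝ × ℝ) : ℂ :=
  Complex.exp (((2 * Real.pi * (x.1 * p.1 + x.2 * p.2) : ℝ) : ℂ) * Complex.I)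

lemma norm_planeWave (x p : ℝ × ℝ) : ‖planeWave x p‖ = 1 := Complex.norm_exp_ofReal_mul_I _

lemma continuous_planeWave (x : ℝ × ℝ) : Continuous (planeWave x) := by
  unfold planeWave; fun_prop

lemma IFT2_eq (f : ℝ × ℝ → ℂ) (x : ℝ × ℝ) : IFT2 f x = ∫ p, planeWave x p * f p := rfl

lemma FT2_eq (f : ℝ × ℝ → ℂ) (p : ℝ × ℝ) : FT2 f p = ∫ q, planeWave (-q) p * f q := by
  unfold FT2 planeWave
  congr 1; ext q; congr 3
  simp only [Prod.fst_neg, Prod.snd_neg]; push_cast; ring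

/-- Fourier multiplier of `D_x^β W_α(t)`, with Gaussian damping of strength `ε` in the
transverse frequency. -/
def dispSymbol (α : ℝ) (β : ℂ) (ε t : ℝ) (p : ℝ × ℝ) : ℂ :=
  ((|p.1| : ℝ) : ℂ) ^ β * Complex.exp (-Complex.I * (t : ℂ) *
      ((p.1 ^ 3 + Real.sign p.1 * |p.1| ^ α * p.2 ^ 2 : ℝ) : ℂ)) *
    (Real.exp (-(ε * |p.1| ^ α * p.2 ^ 2)) : ℂ)

lemma norm_exp_neg_I_mul (t s : ℝ) : ‖Complex.exp (-Complex.I * (t : ℂ) * (s : ℂ))‖ = 1 := by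
  rw [show -Complex.I * (t : ℂ) * (s : ℂ) = ((-(t * s) : ℝ) : ℂ) * Complex.I by push_cast; ring]
  exact Complex.norm_exp_ofReal_mul_I _

lemma measurable_realSign : Measurable Real.sign := by
  unfold Real.sign
  exact Measurable.ite measurableSet_Iio measurable_const
    (Measurable.ite measurableSet_Ioi measurable_const measurable_const)

lemma measurable_dispSymbol (α : ℝ) (β : ℂ) (ε t : ℝ) : Measurable (dispSymbol α β ε t) := by
  have := measurable_realSign
  unfold dispSymbol
  fun_prop

lemma norm_dispSymbol {α : ℝ} {β : ℂ} {ε t : ℝ} {p : ℝ × ℝ} (hp : p.1 ≠ 0) :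
    ‖dispSymbol α β ε t p‖ = |p.1| ^ β.re * Real.exp (-(ε * |p.1| ^ α * p.2 ^ 2)) := by
  rw [dispSymbol, norm_mul, norm_mul, norm_exp_neg_I_mul, mul_one,
    Complex.norm_cpow_eq_rpow_re_of_pos (abs_pos.2 hp), Complex.norm_real, Real.norm_eq_abs,
    abs_of_pos (Real.exp_pos _)]

lemma rpow_le_max {a b x : ℝ} (s : ℝ) (ha : 0 < a) (hx : x ∈ Set.Icc a b) :
    x ^ s ≤ max (a ^ s) (b ^ s) := by
  rcases le_total 0 s with hs | hs
  · exact (Real.rpow_le_rpow (ha.le.trans hx.1) hx.2 hs).trans (le_max_right _ _)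
  · exact (Real.rpow_le_rpow_of_nonpos ha hx.1 hs).trans (le_max_left _ _)

lemma min_le_rpow {a b x : ℝ} (s : ℝ) (ha : 0 < a) (hx : x ∈ Set.Icc a b) :
    min (a ^ s) (b ^ s) ≤ x ^ s := by
  rcases le_total 0 s with hs | hs
  · exact (min_le_left _ _).trans (Real.rpow_le_rpow ha.le hx.1 hs)
  · exact (min_le_right _ _).trans (Real.rpow_le_rpow_of_nonpos (ha.trans_le hx.1) hx.2 hs)

/-- The damped symbol is integrable over strips bounded and bounded away from zero in `ξ`. -/
lemma integrable_dispSymbol (α : ℝ) (β : ℂ) {ε : ℝ} (t : ℝ) {a b : ℝ} (hε : 0 < ε) (ha : 0 < a)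
    (hab : a ≤ b) {S : Set ℝ} (hS : MeasurableSet S) (hSf : volume S < ⊤)
    (hSab : ∀ ξ ∈ S, |ξ| ∈ Set.Icc a b) :
    IntegrableOn (dispSymbol α β ε t) (S ×ˢ Set.univ) volume := by
  have hb := ha.trans_le hab
  set M := max (a ^ β.re) (b ^ β.re)
  set c := min (a ^ α) (b ^ α) with hc
  have hc0 : 0 < c := lt_min (Real.rpow_pos_of_pos ha _) (Real.rpow_pos_of_pos hb _)
  have hμ : (volume : Measure (ℝ × ℝ)).restrict (S ×ˢ Set.univ) =
      (volume.restrict S).prod volume := by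
    rw [Measure.volume_eq_prod, ← Measure.prod_restrict, Measure.restrict_univ]
  have : IsFiniteMeasure (volume.restrict S) := ⟨by simpa using hSf⟩
  have hint : Integrable (fun p : ℝ × ℝ => M * Real.exp (-(ε * c) * p.2 ^ 2))
      ((volume.restrict S).prod volume) :=
    (integrable_const M).mul_prod (integrable_exp_neg_mul_sq (by positivity))
  rw [IntegrableOn]
  refine Integrable.mono' (hμ ▸ hint) (measurable_dispSymbol α β ε t).aestronglyMeasurable ?_
  filter_upwards [ae_restrict_mem (hS.prod MeasurableSet.univ)] with p hp
  have hp1 := hSab p.1 hp.1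
  rw [norm_dispSymbol (abs_pos.1 (ha.trans_le hp1.1))]
  refine mul_le_mul (rpow_le_max _ ha hp1) (Real.exp_le_exp.2 ?_) (Real.exp_pos _).le
    (le_max_of_le_left (Real.rpow_nonneg ha.le _))
  have h1 := min_le_rpow α ha hp1
  have h2 : ε * c * p.2 ^ 2 ≤ ε * |p.1| ^ α * p.2 ^ 2 := by gcongr
  linarith

/-- Gaussian integration in the transverse frequency. -/
lemma integral_planeWave_mul_dispSymbol (α : ℝ) (β : ℂ) {ε t u : ℝ} (hε : 0 < ε) (hu : 0 < u)
    (x y : ℝ) :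
    ∫ η : ℝ, planeWave (x, y) (u, η) * dispSymbol α β ε t (u, η) =
      ((Real.pi : ℂ) / (ε + t * Complex.I)) ^ (1 / 2 : ℂ) *
        ((u : ℂ) ^ (β - α / 2) * dispWave α (2 * Real.pi * x) (-t)
          (Real.pi ^ 2 * y ^ 2 / (ε ^ 2 + t ^ 2)) (ε * (Real.pi ^ 2 * y ^ 2 / (ε ^ 2 + t ^ 2))) u) := by
  have hr : 0 < u ^ α := Real.rpow_pos_of_pos hu _
  have hw : (ε + t * Complex.I : ℂ) ≠ 0 := fun h => by
    have := congrArg Complex.re h; simp at this; exact hε.ne' this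
  have hu' : (u : ℂ) ≠ 0 := by exact_mod_cast hu.ne'
  have hr' : ((u ^ α : ℝ) : ℂ) ≠ 0 := by exact_mod_cast hr.ne'
  have hpi : (Real.pi : ℂ) ≠ 0 := by exact_mod_cast Real.pi_ne_zero
  have hre : (-((ε + t * Complex.I) * ((u ^ α : ℝ) : ℂ)) : ℂ).re < 0 := by
    simp; positivity
  have hintegrand : ∀ η : ℝ, planeWave (x, y) (u, η) * dispSymbol α β ε t (u, η) =
      (u : ℂ) ^ β * Complex.exp (-((ε + t * Complex.I) * ((u ^ α : ℝ) : ℂ)) * (η : ℂ) ^ 2 +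
        (2 * Real.pi * y * Complex.I) * η +
          (2 * Real.pi * x * u - t * u ^ 3) * Complex.I) := fun η => by
    simp only [planeWave, dispSymbol, abs_of_pos hu, Real.sign_of_pos hu]
    rw [Complex.ofReal_exp, mul_comm, mul_assoc, mul_assoc, ← Complex.exp_add, ← Complex.exp_add]
    congr 2
    push_cast
    ring
  simp_rw [hintegrand]
  rw [integral_const_mul, integral_cexp_quadratic hre, neg_neg]
  have hroot : ((Real.pi : ℂ) / ((ε + t * Complex.I) * ((u ^ α : ℝ) : ℂ))) ^ (1 / 2 : ℂ) =
      ((Real.pi : ℂ) / (ε + t * Complex.I)) ^ (1 / 2 : ℂ) * (u : ℂ) ^ (-(α / 2) : ℂ) := by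
    rw [Complex.cpow_def_of_ne_zero (div_ne_zero hpi (mul_ne_zero hw hr')),
      Complex.cpow_def_of_ne_zero (div_ne_zero hpi hw), Complex.cpow_def_of_ne_zero hu',
      ← Complex.exp_add]
    have h1 : (Real.pi : ℂ) / ((ε + t * Complex.I) * ((u ^ α : ℝ) : ℂ)) =
        (((u ^ α)⁻¹ : ℝ) : ℂ) * ((Real.pi : ℂ) / (ε + t * Complex.I)) := by
      push_cast; field_simp
    rw [h1, Complex.log_ofReal_mul (inv_pos.2 hr) (div_ne_zero hpi hw), Real.log_inv,
      Real.log_rpow hu, ← Complex.ofReal_log hu.le]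
    congr 1
    push_cast
    ring
  rw [hroot, Complex.cpow_sub _ _ hu', Complex.cpow_neg]
  have hexp : Complex.exp ((2 * Real.pi * x * u - t * u ^ 3) * Complex.I -
      (2 * Real.pi * y * Complex.I) ^ 2 / (4 * -((ε + t * Complex.I) * ((u ^ α : ℝ) : ℂ)))) =
      dispWave α (2 * Real.pi * x) (-t)
          (Real.pi ^ 2 * y ^ 2 / (ε ^ 2 + t ^ 2))
          (ε * (Real.pi ^ 2 * y ^ 2 / (ε ^ 2 + t ^ 2))) u := by
    rw [dispWave, Complex.ofReal_exp, ← Complex.exp_add, dispPhase, Real.rpow_neg hu.le]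
    congr 1
    have h2 : (ε ^ 2 + t ^ 2 : ℂ) ≠ 0 := by
      have : ε ^ 2 + t ^ 2 ≠ 0 := by positivity
      exact_mod_cast this
    have h3 : (ε ^ 2 + t ^ 2 : ℂ) = (ε + t * Complex.I) * (ε - t * Complex.I) := by
      linear_combination (t : ℂ) ^ 2 * Complex.I_sq
    have h4 : (ε - t * Complex.I : ℂ) ≠ 0 := fun h => h2 (by rw [h3, h, mul_zero])
    generalize u ^ α = r at hr'
    push_cast
    rw [h3, mul_pow, Complex.I_sq]
    field_simp
    ring
  rw [hexp]
  ring

/-- Uniform bound for the one-dimensional kernels. -/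
def kernelConst (κ : ℂ) (t : ℝ) : ℝ :=
  (Real.pi / |t|) ^ (1 / 2 : ℝ) * (dispConst κ * (1 / |t| ^ (1 / 3 : ℝ)) ^ (κ.re + 1))

lemma norm_integral_fibre_le {α : ℝ} {β : ℂ} (hα1 : -1 ≤ α) (hβ1 : α / 2 - 1 < β.re)
    (hβ2 : β.re < α / 2) {ε t a b : ℝ} (hε : 0 < ε) (ht : t ≠ 0) (ha : 0 < a) (hab : a ≤ b)
    (x y : ℝ) :
    ‖∫ u in a..b, ∫ η : ℝ, planeWave (x, y) (u, η) * dispSymbol α β ε t (u, η)‖ ≤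
      kernelConst (β - α / 2) t := by
  have hcongr : ∫ u in a..b, ∫ η : ℝ, planeWave (x, y) (u, η) * dispSymbol α β ε t (u, η) =
      ∫ u in a..b, ((Real.pi : ℂ) / (ε + t * Complex.I)) ^ (1 / 2 : ℂ) *
        ((u : ℂ) ^ (β - α / 2) * dispWave α (2 * Real.pi * x) (-t)
          (Real.pi ^ 2 * y ^ 2 / (ε ^ 2 + t ^ 2))
          (ε * (Real.pi ^ 2 * y ^ 2 / (ε ^ 2 + t ^ 2))) u) := by
    refine intervalIntegral.integral_congr fun u hu => ?_
    rw [Set.uIcc_of_le hab] at hu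
    exact integral_planeWave_mul_dispSymbol α β hε (ha.trans_le hu.1) x y
  have htpos : 0 < |t| := abs_pos.2 ht
  have hre : (β - α / 2 : ℂ).re = β.re - α / 2 := by simp
  have hk : 0 ≤ Real.pi ^ 2 * y ^ 2 / (ε ^ 2 + t ^ 2) := by positivity
  rw [hcongr, intervalIntegral.integral_const_mul, norm_mul, kernelConst]
  refine mul_le_mul ?_ ?_ (norm_nonneg _) (by positivity)
  · rw [show (1 / 2 : ℂ) = ((1 / 2 : ℝ) : ℂ) by push_cast; rfl, Complex.norm_cpow_real, norm_div,
      Complex.norm_real, Real.norm_eq_abs, abs_of_pos Real.pi_pos]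
    have h : |t| ≤ ‖(ε + t * Complex.I : ℂ)‖ := by
      have := Complex.abs_im_le_norm (ε + t * Complex.I : ℂ)
      simpa using this
    exact Real.rpow_le_rpow (by positivity)
      (div_le_div_of_nonneg_left Real.pi_pos.le htpos h) (by norm_num)
  · refine norm_integral_cpow_dispWave_le hα1 (by rw [hre]; linarith) (by rw [hre]; linarith)
      hk (mul_nonneg hε.le hk) (Real.rpow_pos_of_pos htpos _) ?_ ha hab
    rw [abs_neg, ← Real.rpow_natCast, ← Real.rpow_mul htpos.le]
    norm_num

/-- The strips `a ≤ |ξ| ≤ b`. -/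
def freqStrip (a b : ℝ) : Set ℝ := Set.Icc a b ∪ Set.Icc (-b) (-a)

lemma abs_mem_of_mem_freqStrip {a b ξ : ℝ} (ha : 0 < a) (h : ξ ∈ freqStrip a b) :
    |ξ| ∈ Set.Icc a b := by
  rcases h with h | h
  · rwa [abs_of_pos (ha.trans_le h.1)]
  · rw [abs_of_neg (by linarith [h.2])]
    exact ⟨by linarith [h.2], by linarith [h.1]⟩

lemma measurableSet_freqStrip (a b : ℝ) : MeasurableSet (freqStrip a b) :=
  measurableSet_Icc.union measurableSet_Icc

lemma volume_freqStrip_lt_top (a b : ℝ) : volume (freqStrip a b) < ⊤ :=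
  measure_union_lt_top measure_Icc_lt_top measure_Icc_lt_top

lemma integrableOn_dispSymbol_freqStrip (α : ℝ) (β : ℂ) {ε : ℝ} (t : ℝ) {a b : ℝ} (hε : 0 < ε)
    (ha : 0 < a) (hab : a ≤ b) :
    IntegrableOn (dispSymbol α β ε t) (freqStrip a b ×ˢ Set.univ) volume :=
  integrable_dispSymbol α β t hε ha hab (measurableSet_freqStrip a b)
    (volume_freqStrip_lt_top a b) fun _ h => abs_mem_of_mem_freqStrip ha h

lemma integrable_planeWave_mul {R : ℝ × ℝ → ℂ} {μ : Measure (ℝ × ℝ)} (hR : Integrable R μ)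
    (z : ℝ × ℝ) : Integrable (fun p => planeWave z p * R p) μ :=
  hR.bdd_mul (continuous_planeWave z).aestronglyMeasurable
    (ae_of_all _ fun p => (norm_planeWave z p).le)

/-- Uniform bound for the regularized kernel. -/
lemma norm_integral_freqStrip_le {α : ℝ} {β : ℂ} (hα1 : -1 ≤ α) (hβ1 : α / 2 - 1 < β.re)
    (hβ2 : β.re < α / 2) {ε t a b : ℝ} (hε : 0 < ε) (ht : t ≠ 0) (ha : 0 < a) (hab : a ≤ b)
    (z : ℝ × ℝ) :
    ‖∫ p in freqStrip a b ×ˢ Set.univ, planeWave z p * dispSymbol α β ε t p‖ ≤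
      2 * kernelConst (β - α / 2) t := by
  have hint := integrable_planeWave_mul (integrableOn_dispSymbol_freqStrip α β t hε ha hab) z
  have hfib : ∀ S : Set ℝ, S ⊆ freqStrip a b →
      ∫ p in S ×ˢ Set.univ, planeWave z p * dispSymbol α β ε t p =
        ∫ ξ in S, ∫ η : ℝ, planeWave z (ξ, η) * dispSymbol α β ε t (ξ, η) := fun S hS => by
    have h := setIntegral_prod (μ := (volume : Measure ℝ)) (ν := (volume : Measure ℝ)) (s := S)
      (t := Set.univ) (fun p => planeWave z p * dispSymbol α β ε t p)
      (IntegrableOn.mono_set hint (Set.prod_mono hS le_rfl))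
    simpa [Measure.volume_eq_prod] using h
  have hdisj : Disjoint (Set.Icc a b ×ˢ (Set.univ : Set ℝ)) (Set.Icc (-b) (-a) ×ˢ Set.univ) := by
    refine Set.Disjoint.set_prod_left (Set.disjoint_left.2 fun x hx hx' => ?_) _ _
    linarith [hx.1, hx'.2]
  have hsub1 : Set.Icc a b ⊆ freqStrip a b := Set.subset_union_left
  have hsub2 : Set.Icc (-b) (-a) ⊆ freqStrip a b := Set.subset_union_right
  have hsplit : freqStrip a b ×ˢ (Set.univ : Set ℝ) =
      Set.Icc a b ×ˢ Set.univ ∪ Set.Icc (-b) (-a) ×ˢ Set.univ := Set.union_prod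
  rw [hsplit, setIntegral_union hdisj (measurableSet_Icc.prod MeasurableSet.univ)
    (IntegrableOn.mono_set hint (Set.prod_mono hsub1 le_rfl))
    (IntegrableOn.mono_set hint (Set.prod_mono hsub2 le_rfl)), hfib _ hsub1, hfib _ hsub2,
    integral_Icc_eq_integral_Ioc, integral_Icc_eq_integral_Ioc,
    ← intervalIntegral.integral_of_le hab, ← intervalIntegral.integral_of_le (by linarith),
    ← intervalIntegral.integral_comp_neg]
  have hneg : ∫ u in a..b, ∫ η : ℝ, planeWave z (-u, η) * dispSymbol α β ε t (-u, η) =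
      ∫ u in a..b, ∫ η : ℝ, planeWave (-z.1, z.2) (u, η) * dispSymbol α β ε (-t) (u, η) := by
    refine intervalIntegral.integral_congr fun u hu => ?_
    rw [Set.uIcc_of_le hab] at hu
    have hu0 : 0 < u := ha.trans_le hu.1
    refine integral_congr_ae (ae_of_all _ fun η => ?_)
    simp only [planeWave, dispSymbol, abs_neg, Real.sign_of_pos hu0,
      Real.sign_of_neg (neg_lt_zero.2 hu0)]
    push_cast
    ring_nf
  rw [hneg]
  have h1 := norm_integral_fibre_le hα1 hβ1 hβ2 hε ht ha hab z.1 z.2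
  have h2 := norm_integral_fibre_le hα1 hβ1 hβ2 hε (neg_ne_zero.2 ht) ha hab (-z.1) z.2
  rw [kernelConst, abs_neg, ← kernelConst] at h2
  refine (norm_add_le _ _).trans ?_
  linarith

/-- Duality: a bounded kernel maps `L¹` to `L^∞`. -/
lemma norm_integral_mul_FT2_le {μ : Measure (ℝ × ℝ)} [SFinite μ] {R ψ : ℝ × ℝ → ℂ} {M : ℝ}
    (hR : Integrable R μ) (hψ : Integrable ψ volume)
    (hM : ∀ z, ‖∫ p, planeWave z p * R p ∂μ‖ ≤ M) (z : ℝ × ℝ) :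
    ‖∫ p, planeWave z p * R p * FT2 ψ p ∂μ‖ ≤ M * ∫ q, ‖ψ q‖ := by
  have hadd : ∀ q p, planeWave z p * planeWave (-q) p = planeWave (z - q) p := fun q p => by
    rw [planeWave, planeWave, planeWave, ← Complex.exp_add]
    congr 1
    simp only [Prod.fst_neg, Prod.snd_neg, Prod.fst_sub, Prod.snd_sub]
    push_cast
    ring
  have h1 : ∫ p, planeWave z p * R p * FT2 ψ p ∂μ =
      ∫ p, ∫ q, planeWave (z - q) p * (R p * ψ q) ∂volume ∂μ := by
    congr 1
    ext p
    rw [FT2_eq, ← integral_const_mul]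
    congr 1
    ext q
    rw [← hadd]
    ring
  have hint : Integrable (Function.uncurry fun p q => planeWave (z - q) p * (R p * ψ q))
      (μ.prod volume) := by
    refine (hR.mul_prod hψ).bdd_mul (c := 1) (Continuous.aestronglyMeasurable ?_)
      (ae_of_all _ fun pq => (norm_planeWave _ _).le)
    unfold planeWave
    fun_prop
  rw [h1, integral_integral_swap hint, ← integral_const_mul]
  refine norm_integral_le_of_norm_le (hψ.norm.const_mul M) (ae_of_all _ fun q => ?_)
  have h2 : ∫ p, planeWave (z - q) p * (R p * ψ q) ∂μ =
      (∫ p, planeWave (z - q) p * R p ∂μ) * ψ q := by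
    rw [← integral_mul_const]
    congr 1
    ext p
    ring
  rw [h2, norm_mul]
  exact mul_le_mul_of_nonneg_right (hM _) (norm_nonneg _)

lemma continuous_FT2 {ψ : ℝ × ℝ → ℂ} (hψ : Integrable ψ volume) : Continuous (FT2 ψ) := by
  have h : FT2 ψ = fun p => ∫ q, planeWave (-q) p * ψ q := funext (FT2_eq ψ)
  rw [h]
  refine continuous_of_dominated (bound := fun q => ‖ψ q‖) (fun p => ?_) (fun p => ?_) hψ.norm ?_
  · refine AEStronglyMeasurable.mul (Continuous.aestronglyMeasurable ?_) hψ.1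
    unfold planeWave
    fun_prop
  · refine ae_of_all _ fun q => ?_
    rw [norm_mul, norm_planeWave, one_mul]
  · refine ae_of_all _ fun q => ?_
    unfold planeWave
    fun_prop

/-- Fourier inversion on `ℝ²` at continuity points. -/
lemma FT2_IFT2_eq {g : ℝ × ℝ → ℂ} (hg : Integrable g volume) (hg' : Integrable (IFT2 g) volume)
    {p : ℝ × ℝ} (hp : ContinuousAt g p) : FT2 (IFT2 g) p = g p := by
  have hmp := WithLp.volume_preserving_ofLp ℝ ℝ
  have hemb : MeasurableEmbedding (WithLp.ofLp : WithLp 2 (ℝ × ℝ) → ℝ × ℝ) :=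
    (MeasurableEquiv.toLp 2 (ℝ × ℝ)).symm.measurableEmbedding
  have hinv : ∀ (f : ℝ × ℝ → ℂ) (w : WithLp 2 (ℝ × ℝ)),
      FourierTransformInv.fourierInv (fun v : WithLp 2 (ℝ × ℝ) => f v.ofLp) w = IFT2 f w.ofLp := by
    intro f w
    rw [Real.fourierInv_eq', IFT2, ← hmp.integral_comp hemb]
    congr 1
  have hfor : ∀ (f : ℝ × ℝ → ℂ) (w : WithLp 2 (ℝ × ℝ)),
      FourierTransform.fourier (fun v : WithLp 2 (ℝ × ℝ) => f v.ofLp) w = FT2 f w.ofLp := by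
    intro f w
    rw [Real.fourier_eq', FT2, ← hmp.integral_comp hemb]
    congr 1; ext v
    simp only [WithLp.prod_inner_apply, smul_eq_mul, RCLike.inner_apply, conj_trivial]
    congr 2
    push_cast
    ring
  set f : WithLp 2 (ℝ × ℝ) → ℂ := fun v => g v.ofLp with hf
  have hfi : Integrable f volume := (hmp.integrable_comp_emb hemb).2 hg
  have hfinv : FourierTransformInv.fourierInv f = fun w => IFT2 g w.ofLp := funext (hinv g)
  have hfinvi : Integrable (FourierTransformInv.fourierInv f) volume := by
    rw [hfinv]; exact (hmp.integrable_comp_emb hemb).2 hg'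
  have hffi : Integrable (FourierTransform.fourier f) volume := by
    have h := hfinvi.comp_neg
    refine h.congr (ae_of_all _ fun v => ?_)
    simp only [Real.fourierInv_eq_fourier_neg, neg_neg]
  have hcont : ContinuousAt f (WithLp.toLp 2 p) :=
    ContinuousAt.comp (g := g) (f := fun v : WithLp 2 (ℝ × ℝ) => v.ofLp) hp
      (WithLp.prod_continuous_ofLp 2 ℝ ℝ).continuousAt
  have key := hfi.fourier_fourierInv_eq hffi hcont
  rw [hfinv, hfor (IFT2 g)] at key
  exact key

lemma FT2_eq_IFT2_neg (f : ℝ × ℝ → ℂ) (p : ℝ × ℝ) : FT2 f p = IFT2 f (-p) := by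
  rw [FT2_eq, IFT2_eq]
  congr 1; ext q
  rw [planeWave, planeWave]
  congr 3
  simp only [Prod.fst_neg, Prod.snd_neg]
  push_cast
  ring

lemma IFT2_eq_zero_of_not_integrable {f : ℝ × ℝ → ℂ} (hf : ¬ Integrable f volume) :
    IFT2 f = 0 := by
  ext z
  refine integral_undef fun h => hf ?_
  refine (integrable_planeWave_mul h (-z)).congr (ae_of_all _ fun p => ?_)
  change planeWave (-z) p * (planeWave z p * f p) = f p
  rw [← mul_assoc, planeWave, planeWave, ← Complex.exp_add]
  have : (((2 * Real.pi * ((-z).1 * p.1 + (-z).2 * p.2) : ℝ) : ℂ) * Complex.I +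
      ((2 * Real.pi * (z.1 * p.1 + z.2 * p.2) : ℝ) : ℂ) * Complex.I) = 0 := by
    simp only [Prod.fst_neg, Prod.snd_neg]
    push_cast
    ring
  rw [this, Complex.exp_zero, one_mul]

lemma IFT2_zero : IFT2 0 = 0 := by
  ext z
  simp [IFT2_eq]

lemma FT2_eq_zero_of_not_integrable {f : ℝ × ℝ → ℂ} (hf : ¬ Integrable f volume) :
    FT2 f = 0 := by
  ext p
  rw [FT2_eq_IFT2_neg, IFT2_eq_zero_of_not_integrable hf]
  rfl

lemma FT2_zero : FT2 0 = 0 := by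
  ext p
  rw [FT2_eq_IFT2_neg, IFT2_zero]
  rfl

lemma continuousAt_realSign {x : ℝ} (hx : x ≠ 0) : ContinuousAt Real.sign x := by
  rcases lt_or_gt_of_ne hx with h | h
  · refine (continuousAt_const (y := (-1 : ℝ))).congr ?_
    filter_upwards [gt_mem_nhds h] with y hy
    exact (Real.sign_of_neg hy).symm
  · refine (continuousAt_const (y := (1 : ℝ))).congr ?_
    filter_upwards [lt_mem_nhds h] with y hy
    exact (Real.sign_of_pos hy).symm

lemma ae_fst_ne_zero : ∀ᵐ p : ℝ × ℝ, p.1 ≠ 0 := by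
  have h : ∀ᵐ x : ℝ, x ≠ 0 := by simp [ae_iff]
  rw [Measure.volume_eq_prod]
  exact Measure.quasiMeasurePreserving_fst.ae h

/-- The Fourier transform of the linear solution on the full-measure set of continuity points. -/
lemma FT2_Wgrp_eq {α t : ℝ} {ψ : ℝ × ℝ → ℂ} (hψ : Integrable ψ volume)
    (hg : Integrable (fun p : ℝ × ℝ => Complex.exp (-Complex.I * (t : ℂ) *
      ((p.1 ^ 3 + Real.sign p.1 * |p.1| ^ α * p.2 ^ 2 : ℝ) : ℂ)) * FT2 ψ p) volume)
    (hu : Integrable (Wgrp α t ψ) volume) {p : ℝ × ℝ} (hp : p.1 ≠ 0) :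
    FT2 (Wgrp α t ψ) p = Complex.exp (-Complex.I * (t : ℂ) *
      ((p.1 ^ 3 + Real.sign p.1 * |p.1| ^ α * p.2 ^ 2 : ℝ) : ℂ)) * FT2 ψ p := by
  refine FT2_IFT2_eq hg hu ?_
  have h1 : ContinuousAt (fun q : ℝ × ℝ => Real.sign q.1) p :=
    ContinuousAt.comp (g := Real.sign) (continuousAt_realSign hp) continuousAt_fst
  have h2 : ContinuousAt (fun q : ℝ × ℝ => |q.1| ^ α) p :=
    (continuous_abs.continuousAt.comp continuousAt_fst).rpow_const (Or.inl (abs_ne_zero.2 hp))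
  have h3 : ContinuousAt (FT2 ψ) p := (continuous_FT2 hψ).continuousAt
  have h4 : ContinuousAt (fun q : ℝ × ℝ => (q.1 ^ 3 + Real.sign q.1 * |q.1| ^ α * q.2 ^ 2 : ℝ)) p := by
    fun_prop
  have h5 := Complex.continuous_ofReal.continuousAt.comp h4
  exact (Complex.continuous_exp.continuousAt.comp (h5.const_mul (-Complex.I * (t : ℂ)))).mul h3

/-- The dispersive estimate at the level of the absolutely convergent frequency integral. -/
lemma norm_integral_dispSymbol_mul_FT2_le {α : ℝ} {β : ℂ} (hα1 : -1 ≤ α)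
    (hβ1 : α / 2 - 1 < β.re) (hβ2 : β.re < α / 2) {t : ℝ} (ht : t ≠ 0) {ψ : ℝ × ℝ → ℂ}
    (hψ : Integrable ψ volume)
    (hi : Integrable (fun p => dispSymbol α β 0 t p * FT2 ψ p) volume) (z : ℝ × ℝ) :
    ‖∫ p, planeWave z p * (dispSymbol α β 0 t p * FT2 ψ p)‖ ≤
      2 * kernelConst (β - α / 2) t * ∫ q, ‖ψ q‖ := by
  set a : ℕ → ℝ := fun n => 1 / ((n : ℝ) + 1) with ha
  have ha0 : ∀ n, 0 < a n := fun n => Nat.one_div_pos_of_nat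
  have hab : ∀ n : ℕ, a n ≤ (n : ℝ) + 1 := fun n => by
    have h1 : (1 : ℝ) ≤ (n : ℝ) + 1 := by linarith [(Nat.cast_nonneg n : (0 : ℝ) ≤ n)]
    exact (div_le_one_of_le₀ h1 (by positivity)).trans h1
  have hlim : Tendsto a atTop (nhds 0) := tendsto_one_div_add_atTop_nhds_zero_nat
  set S : ℕ → Set (ℝ × ℝ) := fun n => freqStrip (a n) ((n : ℝ) + 1) ×ˢ Set.univ with hS
  have hSm : ∀ n, MeasurableSet (S n) := fun n =>
    (measurableSet_freqStrip _ _).prod MeasurableSet.univ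
  set G : ℕ → ℝ × ℝ → ℂ := fun n =>
    (S n).indicator fun p => planeWave z p * dispSymbol α β (a n) t p * FT2 ψ p with hG
  have hbound : ∀ n, ‖∫ p, G n p‖ ≤ 2 * kernelConst (β - α / 2) t * ∫ q, ‖ψ q‖ := fun n => by
    simp only [hG]
    rw [integral_indicator (hSm n)]
    exact norm_integral_mul_FT2_le
      (integrableOn_dispSymbol_freqStrip α β t (ha0 n) (ha0 n) (hab n)) hψ
      (fun z' => norm_integral_freqStrip_le hα1 hβ1 hβ2 (ha0 n) ht (ha0 n) (hab n) z') z
  have htend : Tendsto (fun n => ∫ p, G n p) atTop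
      (nhds (∫ p, planeWave z p * (dispSymbol α β 0 t p * FT2 ψ p))) := by
    refine tendsto_integral_of_dominated_convergence
      (fun p => ‖dispSymbol α β 0 t p * FT2 ψ p‖) (fun n => ?_) hi.norm (fun n => ?_) ?_
    · refine AEStronglyMeasurable.indicator ?_ (hSm n)
      exact ((continuous_planeWave z).aestronglyMeasurable.mul
        (measurable_dispSymbol α β (a n) t).aestronglyMeasurable).mul
          (continuous_FT2 hψ).aestronglyMeasurable
    · filter_upwards [ae_fst_ne_zero] with p hp
      refine (norm_indicator_le_norm_self _ _).trans ?_
      rw [norm_mul, norm_mul, norm_planeWave, one_mul, norm_mul, norm_dispSymbol hp,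
        norm_dispSymbol hp]
      refine mul_le_mul_of_nonneg_right (mul_le_mul_of_nonneg_left (Real.exp_le_exp.2 ?_)
        (Real.rpow_nonneg (abs_nonneg _) _)) (norm_nonneg _)
      have : 0 ≤ a n * |p.1| ^ α * p.2 ^ 2 :=
        mul_nonneg (mul_nonneg (ha0 n).le (Real.rpow_nonneg (abs_nonneg _) _)) (sq_nonneg _)
      linarith
    · filter_upwards [ae_fst_ne_zero] with p hp
      have hp0 : 0 < |p.1| := abs_pos.2 hp
      have hmem : ∀ᶠ n in atTop, p ∈ S n := by
        have h1 : ∀ᶠ n in atTop, a n < |p.1| := hlim.eventually (gt_mem_nhds hp0)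
        have h2 : ∀ᶠ n : ℕ in atTop, |p.1| ≤ (n : ℝ) :=
          tendsto_natCast_atTop_atTop.eventually (eventually_ge_atTop _)
        filter_upwards [h1, h2] with n hn1 hn2
        refine ⟨?_, Set.mem_univ _⟩
        rcases abs_choice p.1 with h | h
        · exact Or.inl ⟨by linarith, by linarith⟩
        · exact Or.inr ⟨by linarith, by linarith⟩
      have hc : Tendsto (fun n => planeWave z p * dispSymbol α β (a n) t p * FT2 ψ p) atTop
          (nhds (planeWave z p * dispSymbol α β 0 t p * FT2 ψ p)) := by
        have hcont : Continuous fun ε => planeWave z p * dispSymbol α β ε t p * FT2 ψ p := by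
          unfold dispSymbol
          fun_prop
        exact (hcont.tendsto 0).comp hlim
      rw [← mul_assoc]
      refine hc.congr' ?_
      filter_upwards [hmem] with n hn
      exact (Set.indicator_of_mem hn (fun p => planeWave z p * dispSymbol α β (a n) t p * FT2 ψ p)).symm
  exact le_of_tendsto htend.norm (Eventually.of_forall hbound)

lemma dispConst_pos {κ : ℂ} (h1 : -1 < κ.re) (h0 : κ.re < 0) : 0 < dispConst κ := by
  have h2 : 0 < κ.re + 1 := by linarith
  have h3 : 0 < -κ.re := by linarith
  unfold dispConst
  positivity

lemma norm_DxC_Wgrp_le {α : ℝ} {β : ℂ} (hα1 : -1 ≤ α)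
    (hβ1 : α / 2 - 1 < β.re) (hβ2 : β.re < α / 2) {t : ℝ} (ht : t ≠ 0) {ψ : ℝ × ℝ → ℂ}
    (hψ : Integrable ψ volume) (z : ℝ × ℝ) :
    ‖DxC β (Wgrp α t ψ) z‖ ≤ 2 * kernelConst (β - α / 2) t * ∫ q, ‖ψ q‖ := by
  have hre : (β - α / 2 : ℂ).re = β.re - α / 2 := by simp
  have hnonneg : 0 ≤ 2 * kernelConst (β - α / 2) t * ∫ q, ‖ψ q‖ := by
    have h1 := dispConst_pos (κ := β - α / 2) (by rw [hre]; linarith) (by rw [hre]; linarith)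
    have h2 : 0 ≤ ∫ q, ‖ψ q‖ := integral_nonneg fun _ => norm_nonneg _
    unfold kernelConst
    positivity
  have hzero : FT2 (Wgrp α t ψ) = 0 → ‖DxC β (Wgrp α t ψ) z‖ ≤
      2 * kernelConst (β - α / 2) t * ∫ q, ‖ψ q‖ := fun h => by
    have h0 : (fun p : ℝ × ℝ => ((|p.1| : ℝ) : ℂ) ^ β * FT2 (Wgrp α t ψ) p) =
        (0 : ℝ × ℝ → ℂ) := by
      ext p; simp [h]
    rw [DxC, h0, IFT2_zero]
    simpa using hnonneg
  by_cases hg : Integrable (fun p : ℝ × ℝ => Complex.exp (-Complex.I * (t : ℂ) *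
      ((p.1 ^ 3 + Real.sign p.1 * |p.1| ^ α * p.2 ^ 2 : ℝ) : ℂ)) * FT2 ψ p) volume
  swap
  · refine hzero ?_
    rw [Wgrp, IFT2_eq_zero_of_not_integrable hg, FT2_zero]
  by_cases hu : Integrable (Wgrp α t ψ) volume
  swap
  · exact hzero (FT2_eq_zero_of_not_integrable hu)
  have hae : (fun p : ℝ × ℝ => ((|p.1| : ℝ) : ℂ) ^ β * FT2 (Wgrp α t ψ) p) =ᵐ[volume]
      fun p => dispSymbol α β 0 t p * FT2 ψ p := by
    filter_upwards [ae_fst_ne_zero] with p hp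
    rw [FT2_Wgrp_eq hψ hg hu hp, dispSymbol]
    simp [mul_assoc]
  by_cases hw : Integrable (fun p : ℝ × ℝ => ((|p.1| : ℝ) : ℂ) ^ β * FT2 (Wgrp α t ψ) p) volume
  swap
  · rw [DxC, IFT2_eq_zero_of_not_integrable hw]
    simpa using hnonneg
  have heq : DxC β (Wgrp α t ψ) z = ∫ p, planeWave z p * (dispSymbol α β 0 t p * FT2 ψ p) := by
    rw [DxC, IFT2_eq]
    refine integral_congr_ae ?_
    filter_upwards [hae] with p hp
    rw [hp]
  rw [heq]
  exact norm_integral_dispSymbol_mul_FT2_le hα1 hβ1 hβ2 ht hψ (hw.congr hae) z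

lemma kernelConst_eq (κ : ℂ) {t : ℝ} (ht : t ≠ 0) :
    kernelConst κ t =
      Real.pi ^ (1 / 2 : ℝ) * dispConst κ * |t| ^ (-((5 + 2 * κ.re) / 6)) := by
  have h : 0 < |t| := abs_pos.2 ht
  rw [kernelConst, Real.div_rpow Real.pi_pos.le h.le, one_div (|t| ^ (1 / 3 : ℝ)),
    ← Real.rpow_neg h.le, ← Real.rpow_mul h.le, div_eq_mul_inv, ← Real.rpow_neg h.le,
    show -((5 + 2 * κ.re) / 6) = -(1 / 2) + -(1 / 3) * (κ.re + 1) by ring, Real.rpow_add h]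
  ring

theorem stmt7 (α : ℝ) (β : ℂ) (hα1 : -1 ≤ α) (hα2 : α ≤ 1)
    (hβ1 : α / 2 - 1 < β.re) (hβ2 : β.re < α / 2) :
    ∃ C > 0, ∀ ψ : ℝ × ℝ → ℂ, Integrable ψ volume → ∀ t : ℝ, t ≠ 0 →
      eLpNorm (DxC β (Wgrp α t ψ)) ⊤ volume ≤
        ENNReal.ofReal (C * |t| ^ (-((5 + 2 * β.re - α) / 6))) * eLpNorm ψ 1 volume := by
  have hre : (β - α / 2 : ℂ).re = β.re - α / 2 := by simp
  have hpos := dispConst_pos (κ := β - α / 2) (by rw [hre]; linarith) (by rw [hre]; linarith)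
  refine ⟨2 * (Real.pi ^ (1 / 2 : ℝ) * dispConst (β - α / 2)), by positivity,
    fun ψ hψ t ht => ?_⟩
  rw [eLpNorm_exponent_top, eLpNorm_one_eq_lintegral_enorm,
    ← ofReal_integral_norm_eq_lintegral_enorm hψ, ← ENNReal.ofReal_mul (by positivity)]
  refine eLpNormEssSup_le_of_ae_bound (ae_of_all _ fun z => ?_)
  have h := norm_DxC_Wgrp_le hα1 hβ1 hβ2 ht hψ z
  rw [kernelConst_eq _ ht, hre,
    show 5 + 2 * (β.re - α / 2) = 5 + 2 * β.re - α by ring, ← mul_assoc] at h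
  exact h
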